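/- Let d ∈ {1,2,3}. There exists a constant C > 0 depending only on d such that for every integer n ≥ 1 (with h = 1/(n+1)), every multi-index k ∈ {1,…,n}^d, and every function R : ℝ^d → ℝ that is twice continuously differentiable on a neighbourhood of [0,1]^d, | ⟨R, φ_k⟩_h − ∫_{[0,1]^d} R(x) φ_k(x) dx | ≤ C h² λ_k ‖R‖_{H²}. -/

import Mathlib

open MeasureTheory ProbabilityTheory Filter

noncomputable section

/-- The closed unit cube `[0,1]^d`. -/
def cube (d : ℕ) : Set (Fin d → ℝ) := Set.Icc 0 1

/-- Mesh size `h = 1/(n+1)`. -/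
def mesh (n : ℕ) : ℝ := 1 / (n + 1)

/-- The interior grid point `x_i = i·h` associated with `i ∈ {1,…,n}^d`
(encoded by `i : Fin d → Fin n`, the multi-index being `i + 1`). -/
def gridPt (d n : ℕ) (i : Fin d → Fin n) : Fin d → ℝ :=
  fun j => ((i j : ℕ) + 1) * mesh n

/-- The `L²`-normalised Dirichlet eigenfunction
`φ_k(x) = 2^{d/2} ∏_j sin(k_j π x_j)` of `-Δ` on `(0,1)^d`, for the multi-index
`k + 1` with `k : Fin d → ℕ`. -/
def eigenFun (d : ℕ) (k : Fin d → ℕ) (x : Fin d → ℝ) : ℝ :=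
  (2 : ℝ) ^ ((d : ℝ) / 2) * ∏ j, Real.sin (((k j : ℝ) + 1) * Real.pi * x j)

/-- The Dirichlet eigenvalue `λ_k = π² ∑_j k_j²` for the multi-index `k + 1`. -/
def lamC (d : ℕ) (k : Fin d → ℕ) : ℝ :=
  Real.pi ^ 2 * ∑ j, ((k j : ℝ) + 1) ^ 2

/-- The eigenvalue `λ_k^{(h)} = (4/h²) ∑_j sin²(k_j π h / 2)` of the discretised
Dirichlet Laplacian, for `k ∈ {1,…,n}^d` encoded by `k : Fin d → Fin n`. -/
def lamD (d n : ℕ) (k : Fin d → Fin n) : ℝ :=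
  4 / mesh n ^ 2 * ∑ j, Real.sin ((((k j : ℕ) : ℝ) + 1) * Real.pi * mesh n / 2) ^ 2

/-- The discrete inner product `⟨u,v⟩_h = h^d ∑_{i∈{1,…,n}^d} u(x_i) v(x_i)`. -/
def dInner (d n : ℕ) (u v : (Fin d → ℝ) → ℝ) : ℝ :=
  mesh n ^ d * ∑ i : Fin d → Fin n, u (gridPt d n i) * v (gridPt d n i)

/-- The partial derivative `∂_j f`. -/
def pd (d : ℕ) (j : Fin d) (f : (Fin d → ℝ) → ℝ) : (Fin d → ℝ) → ℝ :=
  fun x => fderiv ℝ f x (Pi.single j 1)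

/-- The squared Sobolev norm
`‖f‖_{H²}² = ∑_{|α| ≤ 2} ∫_{(0,1)^d} |D^α f|²`, the order-two multi-indices being the
unordered pairs `j ≤ j'`. -/
def H2sq (d : ℕ) (f : (Fin d → ℝ) → ℝ) : ℝ :=
  (∫ x in cube d, f x ^ 2) + (∑ j : Fin d, ∫ x in cube d, pd d j f x ^ 2) +
    ∑ j : Fin d, ∑ j' : Fin d,
      if j ≤ j' then ∫ x in cube d, pd d j (pd d j' f) x ^ 2 else 0

/-- The squared `Φ`-stochastically weak norm
`‖f‖_Φ² = τ² ∑_{k∈(ℤ_{≥1})^d} (1+λ_k)⁻¹ (∫ f φ_k)²`. -/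
def PhiSq (d : ℕ) (τ : ℝ) (f : (Fin d → ℝ) → ℝ) : ℝ :=
  τ ^ 2 * ∑' k : Fin d → ℕ,
    (1 + lamC d k)⁻¹ * (∫ x in cube d, f x * eigenFun d k x) ^ 2

/-- `f` is twice continuously differentiable on a neighbourhood of `[0,1]^d`. -/
def C2Nbhd (d : ℕ) (f : (Fin d → ℝ) → ℝ) : Prop :=
  ∃ U : Set (Fin d → ℝ), IsOpen U ∧ cube d ⊆ U ∧ ContDiffOn ℝ 2 f U

end

theorem ContinuousOn.norm_bilinear {d : ℕ} {X : Type*} [TopologicalSpace X] {s : Set X}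
    {A : X → (Fin d → ℝ) →L[ℝ] (Fin d → ℝ) →L[ℝ] ℝ} (hA : ContinuousOn A s) :
    ContinuousOn (fun x => ‖A x‖) s :=
  ContinuousOn.norm (E := (Fin d → ℝ) →L[ℝ] (Fin d → ℝ) →L[ℝ] ℝ) hA

/-- Cauchy–Schwarz against the constant function `1`. -/
theorem setIntegral_le_sqrt_volume_mul {d : ℕ} {Q : Set (Fin d → ℝ)} (hQ : IsCompact Q)
    {F : (Fin d → ℝ) → ℝ} (hF : ContinuousOn F Q) :
    ∫ x in Q, F x ≤ Real.sqrt (volume.real Q) * Real.sqrt (∫ x in Q, F x ^ 2) := by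
  have hi : IntegrableOn F Q := hF.integrableOn_compact hQ
  have hi2 : IntegrableOn (fun x => F x ^ 2) Q := (hF.pow 2).integrableOn_compact hQ
  rw [← Real.sqrt_mul measureReal_nonneg]
  apply Real.le_sqrt_of_sq_le
  set V := volume.real Q
  set I := ∫ x in Q, F x
  set J := ∫ x in Q, F x ^ 2
  have key : ∀ m : ℝ, 0 ≤ J - 2 * m * I + m ^ 2 * V := by
    intro m
    have h0 : 0 ≤ ∫ x in Q, (F x - m) ^ 2 := integral_nonneg fun x => sq_nonneg _
    have h1 : ∫ x in Q, (F x - m) ^ 2 = J - 2 * m * I + m ^ 2 * V := by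
      have hc : IntegrableOn (fun _ : Fin d → ℝ => m ^ 2) Q :=
        continuousOn_const.integrableOn_compact hQ
      have hsub : IntegrableOn (fun x => F x ^ 2 - 2 * m * F x) Q := hi2.sub (hi.const_mul (2 * m))
      have : ∀ x, (F x - m) ^ 2 = F x ^ 2 - 2 * m * F x + m ^ 2 := fun x => by ring
      simp_rw [this]
      rw [integral_add hsub hc,
        integral_sub hi2 (hi.const_mul (2 * m)), integral_const_mul, setIntegral_const,
        smul_eq_mul, mul_comm V]
    rwa [h1] at h0
  have hV : 0 ≤ V := measureReal_nonneg
  rcases hV.eq_or_lt with hV0 | hVpos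
  · have hI : I = 0 := by
      by_contra hne
      have := key ((J + 1) / (2 * I))
      have hcancel : 2 * ((J + 1) / (2 * I)) * I = J + 1 := by field_simp
      rw [← hV0, hcancel] at this
      linarith
    rw [hI, ← hV0]
    simp
  · have := key (I / V)
    field_simp at this
    nlinarith

/-- Contracting a compact convex set towards one of its points by the ratio `s` multiplies the
integral of a nonnegative function by at most `s⁻ᵈ`. -/
theorem setIntegral_comp_contraction_le {d : ℕ} {Q : Set (Fin d → ℝ)} (hQ : IsCompact Q)
    (hconv : Convex ℝ Q) {F : (Fin d → ℝ) → ℝ} (hF : ContinuousOn F Q) (hF0 : ∀ x, 0 ≤ F x)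
    {v : Fin d → ℝ} (hv : v ∈ Q) {s : ℝ} (hs : 0 < s) (hs1 : s ≤ 1) :
    ∫ y in Q, F (v + s • (y - v)) ≤ (s ^ d)⁻¹ * ∫ y in Q, F y := by
  set G : (Fin d → ℝ) → ℝ := Q.indicator F
  have hG : Integrable G :=
    (integrable_indicator_iff hQ.measurableSet).2 (hF.integrableOn_compact hQ)
  have hG0 : ∀ x, 0 ≤ G x := fun x => Set.indicator_nonneg (fun x _ => hF0 x) x
  have hcomp : ∫ y, G (v + s • (y - v)) = (s ^ d)⁻¹ * ∫ y, G y := by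
    rw [integral_sub_right_eq_self (fun y => G (v + s • y)) v,
      Measure.integral_comp_smul volume (fun y => G (v + y)) s, integral_add_left_eq_self,
      abs_of_nonneg (by positivity)]
    simp
  have hGi : Integrable fun y => G (v + s • (y - v)) :=
    ((hG.comp_add_left v).comp_smul hs.ne').comp_sub_right v
  calc ∫ y in Q, F (v + s • (y - v)) = ∫ y in Q, G (v + s • (y - v)) := by
        refine setIntegral_congr_fun hQ.measurableSet fun y hy => ?_
        have : v + s • (y - v) ∈ Q := hconv.add_smul_sub_mem hv hy ⟨hs.le, hs1⟩
        simp [G, this]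
    _ ≤ ∫ y, G (v + s • (y - v)) :=
        setIntegral_le_integral hGi (Eventually.of_forall fun y => hG0 _)
    _ = (s ^ d)⁻¹ * ∫ y in Q, F y := by
        rw [hcomp, integral_indicator hQ.measurableSet]

/-- First-order Taylor expansion about `y`, evaluated at `v`, with integral remainder weighted
towards `y`. -/
theorem abs_taylor_le_integral {d : ℕ} {Q : Set (Fin d → ℝ)} (hconv : Convex ℝ Q)
    {f : (Fin d → ℝ) → ℝ} {f' : (Fin d → ℝ) → (Fin d → ℝ) →L[ℝ] ℝ}
    {f'' : (Fin d → ℝ) → (Fin d → ℝ) →L[ℝ] (Fin d → ℝ) →L[ℝ] ℝ}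
    (hf : ∀ x ∈ Q, HasFDerivAt f (f' x) x) (hf' : ∀ x ∈ Q, HasFDerivAt f' (f'' x) x)
    (hf'' : ContinuousOn f'' Q) {v y : Fin d → ℝ} (hv : v ∈ Q) (hy : y ∈ Q) {h : ℝ}
    (hh : ‖y - v‖ ≤ h) :
    |f v - f y + f' y (y - v)| ≤ h ^ 2 * ∫ t in Set.Icc (0 : ℝ) 1, t * ‖f'' (v + t • (y - v))‖ := by
  set p := y - v
  have hmem : ∀ t ∈ Set.Icc (0 : ℝ) 1, v + t • p ∈ Q := fun t ht =>
    hconv.add_smul_sub_mem hv hy ht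
  have hline : ∀ t : ℝ, HasDerivAt (fun t : ℝ => v + t • p) p t := fun t => by
    simpa using ((hasDerivAt_id t).smul_const p).const_add v
  have hcont : ContinuousOn (fun t : ℝ => f'' (v + t • p)) (Set.Icc 0 1) :=
    hf''.comp (by fun_prop) hmem
  have hnorm : ContinuousOn (fun t : ℝ => ‖f'' (v + t • p)‖) (Set.Icc 0 1) := hcont.norm_bilinear
  have hder : ∀ t ∈ Set.uIcc (0 : ℝ) 1,
      HasDerivAt (fun t : ℝ => f (v + t • p) - t * f' (v + t • p) p)
        (-(t * f'' (v + t • p) p p)) t := by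
    intro t ht
    rw [Set.uIcc_of_le zero_le_one] at ht
    have h1 := (hf _ (hmem t ht)).comp_hasDerivAt t (hline t)
    have h2 : HasDerivAt (fun t : ℝ => f' (v + t • p) p) (f'' (v + t • p) p p) t := by
      have h := (ContinuousLinearMap.apply ℝ ℝ p).hasFDerivAt.comp_hasDerivAt t
        ((hf' _ (hmem t ht)).comp_hasDerivAt t (hline t))
      exact h
    have h3 := h1.sub ((hasDerivAt_id t).mul h2)
    refine h3.congr_deriv ?_
    simp only [id, one_mul]
    ring
  have hci : ContinuousOn (fun t : ℝ => -(t * f'' (v + t • p) p p)) (Set.Icc 0 1) :=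
    (continuousOn_id.mul
      ((hcont.clm_apply continuousOn_const).clm_apply continuousOn_const)).neg
  have hInt := intervalIntegral.integral_eq_sub_of_hasDerivAt hder
    ((by rw [Set.uIcc_of_le zero_le_one]; exact hci : ContinuousOn _ _).intervalIntegrable)
  have hval : f v - f y + f' y p = -∫ t in (0 : ℝ)..1, -(t * f'' (v + t • p) p p) := by
    rw [hInt]
    simp [p]
    ring
  rw [hval, abs_neg, intervalIntegral.integral_of_le zero_le_one, ← integral_Icc_eq_integral_Ioc,
    ← integral_const_mul]
  refine (abs_integral_le_integral_abs).trans ?_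
  refine setIntegral_mono_on (hci.abs.integrableOn_compact isCompact_Icc) ?_ measurableSet_Icc ?_
  · exact ContinuousOn.integrableOn_compact isCompact_Icc
      (continuousOn_const.mul (continuousOn_id.mul hnorm))
  · intro t ht
    rw [abs_neg, abs_mul, abs_of_nonneg ht.1]
    have hb : |f'' (v + t • p) p p| ≤ ‖f'' (v + t • p)‖ * ‖p‖ * ‖p‖ :=
      (f'' (v + t • p)).le_opNorm₂ p p
    have hp : ‖p‖ * ‖p‖ ≤ h ^ 2 := by nlinarith [norm_nonneg p]
    calc t * |f'' (v + t • p) p p| ≤ t * (‖f'' (v + t • p)‖ * h ^ 2) := by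
          refine mul_le_mul_of_nonneg_left (hb.trans ?_) ht.1
          rw [mul_assoc]
          gcongr
      _ = h ^ 2 * (t * ‖f'' (v + t • p)‖) := by ring

/-- In dimension at most three the averaged Taylor remainder is controlled in `L²`. -/
theorem integral_taylor_remainder_le {d : ℕ} (hd : d ≤ 3) {Q : Set (Fin d → ℝ)}
    (hQ : IsCompact Q) (hconv : Convex ℝ Q) {W : (Fin d → ℝ) → ℝ} (hW : ContinuousOn W Q)
    {v : Fin d → ℝ} (hv : v ∈ Q) :
    ∫ y in Q, ∫ t in Set.Icc (0 : ℝ) 1, t * W (v + t • (y - v)) ≤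
      2 * (Real.sqrt (volume.real Q) * Real.sqrt (∫ x in Q, W x ^ 2)) := by
  set S := Real.sqrt (volume.real Q) * Real.sqrt (∫ x in Q, W x ^ 2)
  have hS : 0 ≤ S := by positivity
  have hjoint : ContinuousOn (fun q : (Fin d → ℝ) × ℝ => q.2 * W (v + q.2 • (q.1 - v)))
      (Q ×ˢ Set.Icc 0 1) :=
    continuousOn_snd.mul (hW.comp (by fun_prop) fun q hq => hconv.add_smul_sub_mem hv hq.1 hq.2)
  have hInt : Integrable (Function.uncurry fun (y : Fin d → ℝ) (t : ℝ) => t * W (v + t • (y - v)))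
      ((volume.restrict Q).prod (volume.restrict (Set.Icc 0 1))) := by
    rw [Measure.prod_restrict]
    exact hjoint.integrableOn_compact (hQ.prod isCompact_Icc)
  rw [integral_integral_swap hInt]
  have hrp : IntervalIntegrable (fun t : ℝ => S * t ^ (-1 / 2 : ℝ)) volume 0 1 :=
    (intervalIntegral.intervalIntegrable_rpow' (by norm_num)).const_mul _
  have hrpI : IntegrableOn (fun t : ℝ => S * t ^ (-1 / 2 : ℝ)) (Set.Icc 0 1) := by
    rw [integrableOn_Icc_iff_integrableOn_Ioc]
    exact (intervalIntegrable_iff_integrableOn_Ioc_of_le zero_le_one).1 hrp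
  have hval : ∫ t in Set.Icc (0 : ℝ) 1, S * t ^ (-1 / 2 : ℝ) = 2 * S := by
    rw [integral_Icc_eq_integral_Ioc, ← intervalIntegral.integral_of_le zero_le_one,
      intervalIntegral.integral_const_mul, integral_rpow (by norm_num)]
    norm_num
    ring
  rw [← hval]
  rw [integral_Icc_eq_integral_Ioc, integral_Icc_eq_integral_Ioc]
  refine setIntegral_mono_on (hInt.integral_prod_right.mono_measure
    (Measure.restrict_mono Set.Ioc_subset_Icc_self le_rfl))
    (hrpI.mono_set Set.Ioc_subset_Icc_self) measurableSet_Ioc ?_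
  intro t ht
  have hmem : ∀ y ∈ Q, v + t • (y - v) ∈ Q := fun y hy =>
    hconv.add_smul_sub_mem hv hy ⟨ht.1.le, ht.2⟩
  have hc : ContinuousOn (fun y => W (v + t • (y - v))) Q := hW.comp (by fun_prop) hmem
  have h1 := setIntegral_le_sqrt_volume_mul hQ hc
  have h2 := setIntegral_comp_contraction_le hQ hconv (hW.pow 2) (fun x => sq_nonneg _) hv ht.1 ht.2
  have h3 : Real.sqrt (∫ y in Q, W (v + t • (y - v)) ^ 2) ≤
      Real.sqrt ((t ^ d)⁻¹) * Real.sqrt (∫ x in Q, W x ^ 2) := by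
    rw [← Real.sqrt_mul (by have := ht.1; positivity)]
    exact Real.sqrt_le_sqrt h2
  have ht0 := ht.1
  have h4 : t * Real.sqrt ((t ^ d)⁻¹) ≤ t ^ (-1 / 2 : ℝ) := by
    have h5 : (t ^ d)⁻¹ ≤ (t ^ 3)⁻¹ := by
      gcongr ?_⁻¹
      exact pow_le_pow_of_le_one ht0.le ht.2 hd
    have h6 : t ^ (-1 / 2 : ℝ) = t * Real.sqrt ((t ^ 3)⁻¹) := by
      rw [Real.sqrt_eq_rpow, ← Real.rpow_natCast t 3, ← Real.rpow_neg ht0.le,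
        ← Real.rpow_mul ht0.le]
      nth_rewrite 2 [← Real.rpow_one t]
      rw [← Real.rpow_add ht0]
      norm_num
    rw [h6]
    gcongr
  change ∫ y in Q, t * W (v + t • (y - v)) ≤ _
  rw [integral_const_mul]
  calc t * ∫ y in Q, W (v + t • (y - v))
      ≤ t * (Real.sqrt (volume.real Q) *
          (Real.sqrt ((t ^ d)⁻¹) * Real.sqrt (∫ x in Q, W x ^ 2))) := by
        gcongr
        exact h1.trans (by gcongr)
    _ = S * (t * Real.sqrt ((t ^ d)⁻¹)) := by ring
    _ ≤ S * t ^ (-1 / 2 : ℝ) := by gcongr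

theorem clm_apply_eq_sum_single {d : ℕ} {F : Type*} [NormedAddCommGroup F] [NormedSpace ℝ F]
    (L : (Fin d → ℝ) →L[ℝ] F) (v : Fin d → ℝ) : L v = ∑ i, v i • L (Pi.single i 1) := by
  have hv : v = ∑ i, v i • Pi.single i (1 : ℝ) := by
    ext j
    simp [Finset.sum_apply, Pi.single_apply]
  conv_lhs => rw [hv]
  simp

/-- Integration by parts of the first-order terms, by the divergence theorem. -/
theorem abs_integral_first_order_le {d : ℕ} (hd : 0 < d) {a b : Fin d → ℝ} {h : ℝ} (hh : 0 ≤ h)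
    (hab : ∀ i, b i = a i + h) {f' : (Fin d → ℝ) → (Fin d → ℝ) →L[ℝ] ℝ}
    {f'' : (Fin d → ℝ) → (Fin d → ℝ) →L[ℝ] (Fin d → ℝ) →L[ℝ] ℝ}
    (hf' : ∀ x ∈ Set.Icc a b, HasFDerivAt f' (f'' x) x) (hf'' : ContinuousOn f'' (Set.Icc a b)) :
    |(∫ y in Set.Icc a b, f' y (y - a)) + ∫ y in Set.Icc a b, f' y (y - b)| ≤
      d * h ^ 2 * ∫ y in Set.Icc a b, ‖f'' y‖ := by
  obtain ⟨m, rfl⟩ : ∃ m, d = m + 1 := ⟨d - 1, by omega⟩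
  have hle : a ≤ b := fun i => by rw [hab]; linarith
  have hc' : ContinuousOn f' (Set.Icc a b) := fun x hx => (hf' x hx).continuousAt.continuousWithinAt
  set F : Fin (m + 1) → (Fin (m + 1) → ℝ) → ℝ := fun i y =>
    f' y (Pi.single i 1) * ((y i - a i) * (y i - b i)) with hF
  set P : Fin (m + 1) → (Fin (m + 1) → ℝ) →L[ℝ] ℝ := fun i => ContinuousLinearMap.proj i
  set F' : Fin (m + 1) → (Fin (m + 1) → ℝ) → (Fin (m + 1) → ℝ) →L[ℝ] ℝ := fun i y =>
    f' y (Pi.single i 1) • ((y i - a i) • P i + (y i - b i) • P i) +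
      ((y i - a i) * (y i - b i)) •
        (ContinuousLinearMap.apply ℝ ℝ (Pi.single i 1)).comp (f'' y) with hF'
  have hder : ∀ x ∈ Set.Icc a b, ∀ i, HasFDerivAt (F i) (F' i x) x := by
    intro x hx i
    have h1 : HasFDerivAt (fun y => f' y (Pi.single i 1))
        ((ContinuousLinearMap.apply ℝ ℝ (Pi.single i 1)).comp (f'' x)) x := by
      have h := (ContinuousLinearMap.apply ℝ ℝ
        (Pi.single i 1 : Fin (m + 1) → ℝ)).hasFDerivAt.comp x (hf' x hx)
      exact h
    have hP : HasFDerivAt (fun y : Fin (m + 1) → ℝ => y i) (P i) x := (P i).hasFDerivAt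
    exact h1.mul ((hP.sub_const (a i)).mul (hP.sub_const (b i)))
  set Rm : (Fin (m + 1) → ℝ) → ℝ := fun y =>
    ∑ i, ((y i - a i) * (y i - b i)) * f'' y (Pi.single i 1) (Pi.single i 1) with hRm
  have hRc : ContinuousOn Rm (Set.Icc a b) := by
    refine continuousOn_finsetSum _ fun i _ => ContinuousOn.mul (by fun_prop) ?_
    exact (hf''.clm_apply continuousOn_const).clm_apply continuousOn_const
  have hac : ContinuousOn (fun y => f' y (y - a)) (Set.Icc a b) :=
    hc'.clm_apply (by fun_prop)
  have hbc : ContinuousOn (fun y => f' y (y - b)) (Set.Icc a b) :=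
    hc'.clm_apply (by fun_prop)
  have hdiv : ∀ y, ∑ i, F' i y (Pi.single i 1) = f' y (y - a) + f' y (y - b) + Rm y := by
    intro y
    rw [clm_apply_eq_sum_single (f' y) (y - a), clm_apply_eq_sum_single (f' y) (y - b), hRm,
      ← Finset.sum_add_distrib, ← Finset.sum_add_distrib]
    refine Finset.sum_congr rfl fun i _ => ?_
    simp [hF', P]
    ring
  have hInt : IntegrableOn (fun y => ∑ i, F' i y (Pi.single i 1)) (Set.Icc a b) := by
    simp_rw [hdiv]
    exact ((hac.add hbc).add hRc).integrableOn_compact isCompact_Icc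
  have hthm := integral_divergence_of_hasFDerivAt_off_countable' a b hle F F' ∅
    Set.countable_empty
    (fun i x hx => (hder x hx i).continuousAt.continuousWithinAt)
    (fun x hx i => hder x (Set.Icc_subset_Icc le_rfl le_rfl
      ⟨fun i => (hx.1 i (Set.mem_univ i)).1.le, fun i => (hx.1 i (Set.mem_univ i)).2.le⟩) i) hInt
  have hzero : (∫ y in Set.Icc a b, ∑ i, F' i y (Pi.single i 1)) = 0 := by
    rw [hthm]
    simp [hF]
  have hi : ∀ g : (Fin (m + 1) → ℝ) → ℝ, ContinuousOn g (Set.Icc a b) →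
      IntegrableOn g (Set.Icc a b) := fun g hg => hg.integrableOn_compact isCompact_Icc
  simp_rw [hdiv] at hzero
  have habc : ContinuousOn (fun y => f' y (y - a) + f' y (y - b)) (Set.Icc a b) := hac.add hbc
  rw [integral_add (hi _ habc) (hi _ hRc), integral_add (hi _ hac) (hi _ hbc)]
    at hzero
  rw [eq_neg_of_add_eq_zero_left hzero, abs_neg, ← integral_const_mul]
  refine abs_integral_le_integral_abs.trans ?_
  refine setIntegral_mono_on (hi _ hRc.abs) (hi _ (continuousOn_const.mul hf''.norm_bilinear))
    measurableSet_Icc fun y hy => ?_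
  have hterm : ∀ i ∈ Finset.univ, |((y i - a i) * (y i - b i)) *
      f'' y (Pi.single i 1) (Pi.single i 1)| ≤ h ^ 2 * ‖f'' y‖ := by
    intro i _
    have h1 := hy.1 i
    have h2 := hy.2 i
    have h3 := hab i
    rw [abs_mul]
    have h4 : |(y i - a i) * (y i - b i)| ≤ h ^ 2 := by
      rw [abs_le]
      constructor <;> nlinarith
    have h5 : |f'' y (Pi.single i 1) (Pi.single i 1)| ≤ ‖f'' y‖ := by
      have he : ‖(Pi.single i 1 : Fin (m + 1) → ℝ)‖ = 1 := by rw [Pi.norm_single, norm_one]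
      have := (f'' y).le_opNorm₂ (Pi.single i 1) (Pi.single i 1)
      rwa [he, mul_one, mul_one] at this
    gcongr
  refine (Finset.abs_sum_le_sum_abs _ _).trans ((Finset.sum_le_sum hterm).trans (le_of_eq ?_))
  simp
  ring

/-- Two-point quadrature error on a cube of side `h`. -/
theorem abs_cell_error_le {d : ℕ} (hd : 0 < d) (hd3 : d ≤ 3) {a b : Fin d → ℝ} {h : ℝ}
    (hh : 0 ≤ h) (hab : ∀ i, b i = a i + h) {f : (Fin d → ℝ) → ℝ}
    {f' : (Fin d → ℝ) → (Fin d → ℝ) →L[ℝ] ℝ}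
    {f'' : (Fin d → ℝ) → (Fin d → ℝ) →L[ℝ] (Fin d → ℝ) →L[ℝ] ℝ}
    (hf : ∀ x ∈ Set.Icc a b, HasFDerivAt f (f' x) x)
    (hf' : ∀ x ∈ Set.Icc a b, HasFDerivAt f' (f'' x) x) (hf'' : ContinuousOn f'' (Set.Icc a b)) :
    |h ^ d * ((f a + f b) / 2) - ∫ y in Set.Icc a b, f y| ≤
      4 * h ^ 2 * (Real.sqrt (h ^ d) * Real.sqrt (∫ y in Set.Icc a b, ‖f'' y‖ ^ 2)) := by
  set Q := Set.Icc a b with hQdef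
  have hle : a ≤ b := fun i => by rw [hab]; linarith
  have hQ : IsCompact Q := isCompact_Icc
  have hconv : Convex ℝ Q := convex_Icc a b
  have hvol : volume.real Q = h ^ d := by
    rw [Measure.real, Real.volume_Icc_pi_toReal hle]
    simp [hab]
  have hcf : ContinuousOn f Q := fun x hx => (hf x hx).continuousAt.continuousWithinAt
  have hcf' : ContinuousOn f' Q := fun x hx => (hf' x hx).continuousAt.continuousWithinAt
  have hi : ∀ g : (Fin d → ℝ) → ℝ, ContinuousOn g Q → IntegrableOn g Q :=
    fun g hg => hg.integrableOn_compact hQ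
  set S := Real.sqrt (h ^ d) * Real.sqrt (∫ y in Q, ‖f'' y‖ ^ 2) with hS
  have hvertex : ∀ v ∈ Q,
      |h ^ d * f v - (∫ y in Q, f y) + ∫ y in Q, f' y (y - v)| ≤ h ^ 2 * (2 * S) := by
    intro v hv
    have hcv : ContinuousOn (fun y => f' y (y - v)) Q := hcf'.clm_apply (by fun_prop)
    have heq : h ^ d * f v - (∫ y in Q, f y) + ∫ y in Q, f' y (y - v) =
        ∫ y in Q, (f v - f y + f' y (y - v)) := by
      have hsub : ContinuousOn (fun y => f v - f y) Q := continuousOn_const.sub hcf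
      rw [integral_add (hi _ hsub) (hi _ hcv),
        integral_sub (hi _ continuousOn_const) (hi _ hcf), setIntegral_const, hvol, smul_eq_mul]
    have hrem := integral_taylor_remainder_le hd3 hQ hconv hf''.norm_bilinear hv
    rw [hvol] at hrem
    rw [heq]
    refine abs_integral_le_integral_abs.trans ?_
    refine le_trans ?_ (mul_le_mul_of_nonneg_left hrem (sq_nonneg h))
    rw [← integral_const_mul]
    have hjoint : IntegrableOn (fun q : (Fin d → ℝ) × ℝ => q.2 * ‖f'' (v + q.2 • (q.1 - v))‖)
        (Q ×ˢ Set.Icc 0 1) :=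
      (continuousOn_snd.mul (hf''.norm_bilinear.comp (by fun_prop)
        fun q hq => hconv.add_smul_sub_mem hv hq.1 hq.2)).integrableOn_compact
          (hQ.prod isCompact_Icc)
    rw [IntegrableOn, Measure.volume_eq_prod, ← Measure.prod_restrict] at hjoint
    refine setIntegral_mono_on (hi _ ((continuousOn_const.sub hcf).add hcv).abs)
      (hjoint.integral_prod_left.const_mul _) hQ.measurableSet fun y hy => ?_
    refine abs_taylor_le_integral hconv hf hf' hf'' hv hy ?_
    refine (pi_norm_le_iff_of_nonneg hh).2 fun i => ?_
    have h1 := hy.1 i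
    have h2 := hy.2 i
    have h3 := hv.1 i
    have h4 := hv.2 i
    have h5 := hab i
    rw [Real.norm_eq_abs, Pi.sub_apply, abs_le]
    constructor <;> linarith
  have hA := hvertex a ⟨le_rfl, hle⟩
  have hB := hvertex b ⟨hle, le_rfl⟩
  have hAB := abs_integral_first_order_le hd hh hab hf' hf''
  have hCS := setIntegral_le_sqrt_volume_mul hQ hf''.norm_bilinear
  rw [hvol] at hCS
  have hAB' := hAB.trans (mul_le_mul_of_nonneg_left hCS (by positivity))
  have hd' : (d : ℝ) ≤ 3 := by exact_mod_cast hd3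
  have hS0 : 0 ≤ h ^ 2 * S := by positivity
  have hAB'' : d * h ^ 2 * S ≤ 3 * (h ^ 2 * S) := by nlinarith
  rw [abs_le] at hA hB hAB' ⊢
  constructor <;> nlinarith

theorem mesh_pos (n : ℕ) : 0 < mesh n := by
  unfold mesh
  positivity

theorem succ_mul_mesh (n : ℕ) : ((n : ℝ) + 1) * mesh n = 1 := by
  unfold mesh
  field_simp

/-- The grid cells `∏_j [i_j h, (i_j+1) h]` tile the unit cube. -/
theorem setIntegral_cube_eq_sum (d n : ℕ) {F : (Fin d → ℝ) → ℝ} (hF : ContinuousOn F (cube d)) :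
    ∫ x in cube d, F x = ∑ i : Fin d → Fin (n + 1),
      ∫ x in Set.Icc (fun j => ((i j : ℕ) : ℝ) * mesh n)
        (fun j => (((i j : ℕ) : ℝ) + 1) * mesh n), F x := by
  have hm := mesh_pos n
  set T : (Fin d → Fin (n + 1)) → Set (Fin d → ℝ) := fun i =>
    Set.univ.pi fun j => Set.Ico (((i j : ℕ) : ℝ) * mesh n) ((((i j : ℕ) : ℝ) + 1) * mesh n)
    with hT
  have hcell : ∀ i, T i =ᵐ[volume] Set.Icc (fun j => ((i j : ℕ) : ℝ) * mesh n)
      (fun j => (((i j : ℕ) : ℝ) + 1) * mesh n) := fun i => Measure.univ_pi_Ico_ae_eq_Icc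
  have hcube : (Set.univ.pi fun _ : Fin d => Set.Ico (0 : ℝ) 1) =ᵐ[volume] cube d :=
    Measure.univ_pi_Ico_ae_eq_Icc
  have hunion : (Set.univ.pi fun _ : Fin d => Set.Ico (0 : ℝ) 1) = ⋃ i, T i := by
    ext x
    simp only [hT, Set.mem_iUnion, Set.mem_univ_pi, Set.mem_Ico]
    constructor
    · intro hx
      have hlt : ∀ j, ⌊x j / mesh n⌋₊ < n + 1 := fun j => by
        rw [Nat.floor_lt (div_nonneg (hx j).1 hm.le), div_lt_iff₀ hm]
        push_cast
        rw [succ_mul_mesh]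
        exact (hx j).2
      refine ⟨fun j => ⟨⌊x j / mesh n⌋₊, hlt j⟩, fun j => ⟨?_, ?_⟩⟩
      · exact (le_div_iff₀ hm).1 (Nat.floor_le (div_nonneg (hx j).1 hm.le))
      · exact (div_lt_iff₀ hm).1 (Nat.lt_floor_add_one _)
    · rintro ⟨i, hi⟩ j
      refine ⟨le_trans (by positivity) (hi j).1, (hi j).2.trans_le ?_⟩
      refine le_trans ?_ (succ_mul_mesh n).le
      have : ((i j : ℕ) : ℝ) ≤ n := by exact_mod_cast Nat.lt_succ_iff.1 (i j).2
      gcongr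
  have hdisj : Pairwise (Function.onFun Disjoint T) := by
    intro i i' hne
    refine Set.disjoint_left.2 fun x hx hx' => hne ?_
    simp only [hT, Set.mem_univ_pi, Set.mem_Ico] at hx hx'
    funext j
    have h1 : ((i j : ℕ) : ℝ) < ((i' j : ℕ) : ℝ) + 1 :=
      lt_of_mul_lt_mul_right ((hx j).1.trans_lt (hx' j).2) hm.le
    have h2 : ((i' j : ℕ) : ℝ) < ((i j : ℕ) : ℝ) + 1 :=
      lt_of_mul_lt_mul_right ((hx' j).1.trans_lt (hx j).2) hm.le
    have h3 : (i j : ℕ) < (i' j : ℕ) + 1 := by exact_mod_cast h1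
    have h4 : (i' j : ℕ) < (i j : ℕ) + 1 := by exact_mod_cast h2
    exact Fin.ext (by omega)
  have hInt : IntegrableOn F (Set.univ.pi fun _ : Fin d => Set.Ico (0 : ℝ) 1) :=
    (hF.integrableOn_compact isCompact_Icc).congr_set_ae hcube
  rw [← setIntegral_congr_set hcube, hunion, integral_iUnion_fintype
    (fun i => MeasurableSet.univ_pi fun j => measurableSet_Ico) hdisj
    (fun i => hInt.mono_set (hunion ▸ Set.subset_iUnion T i))]
  exact Finset.sum_congr rfl fun i _ => setIntegral_congr_set (hcell i)

theorem sum_lower_corner (d n : ℕ) {g : (Fin d → ℝ) → ℝ} (hg : ∀ x, ∀ j, x j = 0 → g x = 0) :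
    ∑ i : Fin d → Fin (n + 1), g (fun j => ((i j : ℕ) : ℝ) * mesh n) =
      ∑ i : Fin d → Fin n, g (gridPt d n i) := by
  symm
  refine Fintype.sum_of_injective (fun i j => (i j).succ) ?_ _ _ ?_ ?_
  · intro i i' h
    funext j
    exact Fin.succ_injective _ (congrFun h j)
  · intro i hi
    by_contra hne
    refine hi ?_
    have h0 : ∀ j, i j ≠ 0 := fun j hj => hne (hg _ j (by simp [hj]))
    exact ⟨fun j => (i j).pred (h0 j), by simp⟩
  · intro i
    exact congrArg g (funext fun j => by simp [gridPt])

theorem sum_upper_corner (d n : ℕ) {g : (Fin d → ℝ) → ℝ} (hg : ∀ x, ∀ j, x j = 1 → g x = 0) :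
    ∑ i : Fin d → Fin (n + 1), g (fun j => (((i j : ℕ) : ℝ) + 1) * mesh n) =
      ∑ i : Fin d → Fin n, g (gridPt d n i) := by
  symm
  refine Fintype.sum_of_injective (fun i j => (i j).castSucc) ?_ _ _ ?_ ?_
  · intro i i' h
    funext j
    exact Fin.castSucc_injective _ (congrFun h j)
  · intro i hi
    by_contra hne
    refine hi ?_
    have h0 : ∀ j, i j ≠ Fin.last n := fun j hj =>
      hne (hg _ j (by simp [hj, succ_mul_mesh]))
    exact ⟨fun j => (i j).castPred (h0 j), by simp⟩
  · intro i
    exact congrArg g (funext fun j => by simp [gridPt])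

/-- The trapezoid-rule error estimate for functions vanishing on the boundary of the cube. -/
theorem abs_trapezoid_error_le {d : ℕ} (hd : 0 < d) (hd3 : d ≤ 3) (n : ℕ)
    {g : (Fin d → ℝ) → ℝ} {g' : (Fin d → ℝ) → (Fin d → ℝ) →L[ℝ] ℝ}
    {g'' : (Fin d → ℝ) → (Fin d → ℝ) →L[ℝ] (Fin d → ℝ) →L[ℝ] ℝ}
    (hg : ∀ x ∈ cube d, HasFDerivAt g (g' x) x) (hg' : ∀ x ∈ cube d, HasFDerivAt g' (g'' x) x)
    (hg'' : ContinuousOn g'' (cube d)) (h0 : ∀ x, ∀ j, x j = 0 → g x = 0)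
    (h1 : ∀ x, ∀ j, x j = 1 → g x = 0) :
    |mesh n ^ d * ∑ i : Fin d → Fin n, g (gridPt d n i) - ∫ x in cube d, g x| ≤
      4 * mesh n ^ 2 * Real.sqrt (∫ x in cube d, ‖g'' x‖ ^ 2) := by
  have hm := mesh_pos n
  set h := mesh n with hh
  set a : (Fin d → Fin (n + 1)) → Fin d → ℝ := fun i j => ((i j : ℕ) : ℝ) * h with ha
  set b : (Fin d → Fin (n + 1)) → Fin d → ℝ := fun i j => (((i j : ℕ) : ℝ) + 1) * h with hb
  have hsub : ∀ i, Set.Icc (a i) (b i) ⊆ cube d := fun i => by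
    refine Set.Icc_subset_Icc (fun j => ?_) (fun j => ?_)
    · simp only [ha, Pi.zero_apply]
      positivity
    · simp only [hb, Pi.one_apply]
      refine le_trans ?_ (succ_mul_mesh n).le
      have : ((i j : ℕ) : ℝ) ≤ n := by exact_mod_cast Nat.lt_succ_iff.1 (i j).2
      gcongr
  have hcell := fun i => abs_cell_error_le hd hd3 hm.le
    (a := a i) (b := b i) (fun j => by simp only [ha, hb]; ring)
    (fun x hx => hg x (hsub i hx)) (fun x hx => hg' x (hsub i hx)) (hg''.mono (hsub i))
  have hcg : ContinuousOn g (cube d) := fun x hx => (hg x hx).continuousAt.continuousWithinAt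
  have hW : ContinuousOn (fun x => ‖g'' x‖ ^ 2) (cube d) := hg''.norm_bilinear.pow 2
  have hsum : h ^ d * ∑ i : Fin d → Fin n, g (gridPt d n i) =
      ∑ i, h ^ d * ((g (a i) + g (b i)) / 2) := by
    rw [← Finset.mul_sum, ← Finset.sum_div, Finset.sum_add_distrib, sum_lower_corner d n h0,
      sum_upper_corner d n h1]
    ring
  have hone : ∑ _i : Fin d → Fin (n + 1), h ^ d = 1 := by
    simp only [Finset.sum_const, Finset.card_univ, Fintype.card_pi, Fintype.card_fin,
      Finset.prod_const, nsmul_eq_mul]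
    push_cast
    rw [← mul_pow, succ_mul_mesh, one_pow]
  rw [hsum, setIntegral_cube_eq_sum d n hcg, setIntegral_cube_eq_sum d n hW,
    ← Finset.sum_sub_distrib]
  refine (Finset.abs_sum_le_sum_abs _ _).trans ((Finset.sum_le_sum fun i _ => hcell i).trans ?_)
  rw [← Finset.mul_sum]
  refine mul_le_mul_of_nonneg_left ?_ (by positivity)
  refine (Real.sum_sqrt_mul_sqrt_le Finset.univ (fun i => by positivity)
    (fun i => integral_nonneg fun x => sq_nonneg _)).trans ?_
  rw [hone, Real.sqrt_one, one_mul]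

theorem norm_clm_le_sum_single {d : ℕ} {F : Type*} [NormedAddCommGroup F] [NormedSpace ℝ F]
    (L : (Fin d → ℝ) →L[ℝ] F) : ‖L‖ ≤ ∑ i, ‖L (Pi.single i 1)‖ := by
  refine L.opNorm_le_bound (Finset.sum_nonneg fun i _ => norm_nonneg _) fun v => ?_
  rw [clm_apply_eq_sum_single L v, Finset.sum_mul]
  refine norm_sum_le_of_le _ fun i _ => ?_
  rw [norm_smul, mul_comm]
  gcongr
  exact norm_le_pi_norm v i

theorem contDiff_eigenFun (d : ℕ) (k : Fin d → ℕ) {m : WithTop ℕ∞} :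
    ContDiff ℝ m (eigenFun d k) := by
  unfold eigenFun
  refine contDiff_const.mul (contDiff_prod fun j _ => Real.contDiff_sin.comp ?_)
  exact contDiff_const.mul (contDiff_apply ℝ ℝ j)

theorem norm_iteratedFDeriv_sin_mul_le {d : ℕ} (j : Fin d) {c : ℝ} (hc : 0 ≤ c) (m : ℕ)
    (x : Fin d → ℝ) :
    ‖iteratedFDeriv ℝ m (fun y : Fin d → ℝ => Real.sin (c * y j)) x‖ ≤ c ^ m := by
  set L : (Fin d → ℝ) →L[ℝ] ℝ := c • ContinuousLinearMap.proj j
  have hL : ‖L‖ ≤ c := L.opNorm_le_bound hc fun v => by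
    have hv : L v = c * v j := by simp [L]
    rw [hv, norm_mul, Real.norm_of_nonneg hc]
    gcongr
    exact norm_le_pi_norm v j
  have hcomp : (fun y : Fin d → ℝ => Real.sin (c * y j)) = Real.sin ∘ L := by
    ext y
    simp [L]
  rw [hcomp, L.iteratedFDeriv_comp_right (n := m) Real.contDiff_sin x le_rfl]
  refine (ContinuousMultilinearMap.norm_compContinuousLinearMap_le _ _).trans ?_
  have h1 : ‖iteratedFDeriv ℝ m Real.sin (L x)‖ ≤ 1 := by
    rw [norm_iteratedFDeriv_eq_norm_iteratedDeriv]
    exact Real.abs_iteratedDeriv_sin_le_one m _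
  calc _ ≤ 1 * ∏ _i : Fin m, c := by gcongr
    _ = c ^ m := by simp

theorem freq_le_sqrt_lamC (d : ℕ) (k : Fin d → ℕ) (j : Fin d) :
    ((k j : ℝ) + 1) * Real.pi ≤ Real.sqrt (lamC d k) := by
  refine Real.le_sqrt_of_sq_le ?_
  unfold lamC
  rw [mul_pow, mul_comm]
  gcongr
  exact Finset.single_le_sum (f := fun j => ((k j : ℝ) + 1) ^ 2) (fun i _ => sq_nonneg _)
    (Finset.mem_univ j)

theorem one_le_sqrt_lamC {d : ℕ} (hd : 0 < d) (k : Fin d → ℕ) : 1 ≤ Real.sqrt (lamC d k) := by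
  refine le_trans ?_ (freq_le_sqrt_lamC d k ⟨0, hd⟩)
  have h1 : (0 : ℝ) ≤ k ⟨0, hd⟩ := Nat.cast_nonneg _
  nlinarith [Real.pi_gt_three]

theorem exists_norm_iteratedFDeriv_eigenFun_le (d m : ℕ) :
    ∃ K : ℝ, 0 ≤ K ∧ ∀ (k : Fin d → ℕ) (x : Fin d → ℝ),
      ‖iteratedFDeriv ℝ m (eigenFun d k) x‖ ≤ K * Real.sqrt (lamC d k) ^ m := by
  refine ⟨(2 : ℝ) ^ ((d : ℝ) / 2) *
    ∑ p ∈ (Finset.univ : Finset (Fin d)).sym m, ((p : Multiset (Fin d)).countPerms : ℝ),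
    by positivity, fun k x => ?_⟩
  have hs : ∀ j ∈ (Finset.univ : Finset (Fin d)), ContDiff ℝ m
      (fun y : Fin d → ℝ => Real.sin (((k j : ℝ) + 1) * Real.pi * y j)) := fun j _ =>
    Real.contDiff_sin.comp (contDiff_const.mul (contDiff_apply ℝ ℝ j))
  have heq : eigenFun d k = (2 : ℝ) ^ ((d : ℝ) / 2) •
      fun y : Fin d → ℝ => ∏ j, Real.sin (((k j : ℝ) + 1) * Real.pi * y j) := rfl
  rw [heq, iteratedFDeriv_const_smul_apply (contDiff_prod hs).contDiffAt, norm_smul,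
    Real.norm_of_nonneg (by positivity), mul_assoc]
  refine mul_le_mul_of_nonneg_left ?_ (by positivity)
  refine (norm_iteratedFDeriv_prod_le hs le_rfl).trans ?_
  rw [Finset.sum_mul]
  refine Finset.sum_le_sum fun p _ => mul_le_mul_of_nonneg_left ?_ (Nat.cast_nonneg _)
  calc _ ≤ ∏ j : Fin d, Real.sqrt (lamC d k) ^ Multiset.count j (p : Multiset (Fin d)) := by
        refine Finset.prod_le_prod (fun j _ => norm_nonneg _) fun j _ => ?_
        refine (norm_iteratedFDeriv_sin_mul_le j (by positivity) _ x).trans ?_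
        exact pow_le_pow_left₀ (by positivity) (freq_le_sqrt_lamC d k j) _
    _ = Real.sqrt (lamC d k) ^ m := by
        rw [Finset.prod_pow_eq_pow_sum, Multiset.sum_count_eq_card fun _ _ => Finset.mem_univ _]
        exact congrArg _ p.2

theorem norm_iteratedFDeriv_two {d : ℕ} (g : (Fin d → ℝ) → ℝ) (x : Fin d → ℝ) :
    ‖iteratedFDeriv ℝ 2 g x‖ = ‖fderiv ℝ (fderiv ℝ g) x‖ := by
  rw [← norm_iteratedFDeriv_fderiv (n := 1), norm_iteratedFDeriv_one]

/-- The second derivative of `R φ_k` is controlled by `λ_k` and the derivatives of `R`. -/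
theorem exists_norm_fderiv_fderiv_mul_eigenFun_le {d : ℕ} (hd : 0 < d) :
    ∃ K : ℝ, 0 < K ∧ ∀ (k : Fin d → ℕ) (R : (Fin d → ℝ) → ℝ) (U : Set (Fin d → ℝ)), IsOpen U →
      ContDiffOn ℝ 2 R U → ∀ x ∈ U,
      ‖fderiv ℝ (fderiv ℝ fun y => R y * eigenFun d k y) x‖ ≤
        K * lamC d k * (|R x| + 2 * ‖fderiv ℝ R x‖ + ‖fderiv ℝ (fderiv ℝ R) x‖) := by
  choose B hB0 hB using exists_norm_iteratedFDeriv_eigenFun_le d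
  refine ⟨B 0 + B 1 + B 2 + 1, by linarith [hB0 0, hB0 1, hB0 2], fun k R U hU hR x hx => ?_⟩
  set Λ := Real.sqrt (lamC d k) with hΛ
  have hΛ1 : 1 ≤ Λ := one_le_sqrt_lamC hd k
  have hΛ2 : lamC d k = Λ ^ 2 := by
    rw [hΛ, Real.sq_sqrt]
    unfold lamC
    positivity
  set K := B 0 + B 1 + B 2 + 1
  have hφ : ∀ m ≤ 2, ‖iteratedFDeriv ℝ m (eigenFun d k) x‖ ≤ K * Λ ^ 2 := by
    intro m hm
    refine (hB m k x).trans ?_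
    have h1 : B m ≤ K := by
      have := hB0 0
      have := hB0 1
      have := hB0 2
      interval_cases m <;> simp only [K] <;> linarith
    have h2 : Λ ^ m ≤ Λ ^ 2 := pow_le_pow_right₀ hΛ1 hm
    exact mul_le_mul h1 h2 (by positivity) ((hB0 m).trans h1)
  have hmul := norm_iteratedFDerivWithin_mul_le hR
    ((contDiff_eigenFun d k (m := 2)).contDiffOn (s := U)) hU.uniqueDiffOn hx (n := 2) le_rfl
  simp only [iteratedFDerivWithin_of_isOpen _ hU hx, Finset.sum_range_succ, Finset.sum_range_zero,
    norm_iteratedFDeriv_two] at hmul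
  norm_num at hmul
  rw [hΛ2]
  refine hmul.trans ?_
  have h0 := mul_le_mul_of_nonneg_left (hφ (2 - 0) (by norm_num)) (abs_nonneg (R x))
  have h1 := mul_le_mul_of_nonneg_left (hφ (2 - 1) (by norm_num))
    (mul_nonneg zero_le_two (norm_nonneg (fderiv ℝ R x)))
  have h2 := mul_le_mul_of_nonneg_left (hφ (2 - 2) (by norm_num))
    (ContinuousLinearMap.opNorm_nonneg (fderiv ℝ (fderiv ℝ R) x))
  linarith

theorem pd_pd_eq {d : ℕ} {R : (Fin d → ℝ) → ℝ} {x : Fin d → ℝ}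
    (hR : DifferentiableAt ℝ (fderiv ℝ R) x) (j j' : Fin d) :
    pd d j (pd d j' R) x = fderiv ℝ (fderiv ℝ R) x (Pi.single j 1) (Pi.single j' 1) := by
  have h := (ContinuousLinearMap.apply ℝ ℝ
    (Pi.single j' 1 : Fin d → ℝ)).hasFDerivAt.comp x hR.hasFDerivAt
  have h' : HasFDerivAt (pd d j' R) _ x := h
  rw [pd, h'.fderiv]
  rfl

theorem sum_sum_le_two_mul_sum_le {d : ℕ} {A : Fin d → Fin d → ℝ} (h0 : ∀ i j, 0 ≤ A i j)
    (hsymm : ∀ i j, A i j = A j i) :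
    ∑ i, ∑ j, A i j ≤ 2 * ∑ i, ∑ j, if i ≤ j then A i j else 0 := by
  have hswap : ∑ i, ∑ j, (if i ≤ j then A i j else 0) = ∑ i, ∑ j, if j ≤ i then A i j else 0 := by
    rw [Finset.sum_comm]
    simp_rw [hsymm]
  rw [two_mul]
  nth_rewrite 2 [hswap]
  simp_rw [← Finset.sum_add_distrib]
  refine Finset.sum_le_sum fun i _ => Finset.sum_le_sum fun j _ => ?_
  have := h0 i j
  rcases le_total i j with h | h <;> simp only [h, if_true] <;> split_ifs <;> linarith

/-- The operator norms of the derivatives up to order two are controlled by the `H²` norm. -/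
theorem integral_sq_derivs_le {d : ℕ} (hd : 0 < d) {R : (Fin d → ℝ) → ℝ} {U : Set (Fin d → ℝ)}
    (hU : IsOpen U) (hcU : cube d ⊆ U) (hR : ContDiffOn ℝ 2 R U) :
    ∫ x in cube d, (|R x| + 2 * ‖fderiv ℝ R x‖ + ‖fderiv ℝ (fderiv ℝ R) x‖) ^ 2 ≤
      (4 * d) ^ 2 * H2sq d R := by
  have hR' : ContDiffOn ℝ 1 (fderiv ℝ R) U := hR.fderiv_of_isOpen hU (by norm_num)
  have hc0 : ContinuousOn R (cube d) := hR.continuousOn.mono hcU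
  have hc1 : ContinuousOn (fderiv ℝ R) (cube d) := hR'.continuousOn.mono hcU
  have hc2 : ContinuousOn (fderiv ℝ (fderiv ℝ R)) (cube d) :=
    (hR'.continuousOn_fderiv_of_isOpen hU le_rfl).mono hcU
  have hi : ∀ g : (Fin d → ℝ) → ℝ, ContinuousOn g (cube d) → IntegrableOn g (cube d) :=
    fun g hg => hg.integrableOn_compact isCompact_Icc
  have hpd : ∀ x ∈ cube d, ∀ j j', pd d j (pd d j' R) x =
      fderiv ℝ (fderiv ℝ R) x (Pi.single j 1) (Pi.single j' 1) := fun x hx =>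
    pd_pd_eq ((hR'.differentiableOn one_ne_zero).differentiableAt (hU.mem_nhds (hcU hx)))
  have hi0 : IntegrableOn (fun x => R x ^ 2) (cube d) := hi _ (hc0.pow 2)
  have hi1 : ∀ j, IntegrableOn (fun x => pd d j R x ^ 2) (cube d) := fun j =>
    hi _ ((hc1.clm_apply continuousOn_const).pow 2)
  have hi2 : ∀ j j', IntegrableOn (fun x => pd d j (pd d j' R) x ^ 2) (cube d) := fun j j' =>
    hi _ ((((hc2.clm_apply continuousOn_const).clm_apply continuousOn_const).congr
      fun x hx => hpd x hx j j').pow 2)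
  have hi2' : ∀ j j', IntegrableOn
      (fun x => if j ≤ j' then pd d j (pd d j' R) x ^ 2 else 0) (cube d) := fun j j' => by
    split_ifs
    · exact hi2 j j'
    · exact integrableOn_zero
  have hi1s : IntegrableOn (fun x => ∑ j, pd d j R x ^ 2) (cube d) :=
    integrable_finsetSum _ fun j _ => hi1 j
  have hi2s : ∀ j, IntegrableOn
      (fun x => ∑ j', if j ≤ j' then pd d j (pd d j' R) x ^ 2 else 0) (cube d) := fun j =>
    integrable_finsetSum _ fun j' _ => hi2' j j'
  have hi2ss : IntegrableOn
      (fun x => ∑ j, ∑ j', if j ≤ j' then pd d j (pd d j' R) x ^ 2 else 0) (cube d) :=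
    integrable_finsetSum _ fun j _ => hi2s j
  have hi01 : IntegrableOn (fun x => R x ^ 2 + ∑ j, pd d j R x ^ 2) (cube d) := hi0.add hi1s
  have hH : H2sq d R = ∫ x in cube d, (R x ^ 2 + ∑ j, pd d j R x ^ 2 +
      ∑ j, ∑ j', if j ≤ j' then pd d j (pd d j' R) x ^ 2 else 0) := by
    rw [integral_add hi01 hi2ss, integral_add hi0 hi1s,
      integral_finsetSum _ fun j _ => hi1 j, integral_finsetSum _ fun j _ => hi2s j]
    simp_rw [integral_finsetSum _ fun j' _ => hi2' _ j']
    unfold H2sq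
    congr 1
    refine Finset.sum_congr rfl fun j _ => Finset.sum_congr rfl fun j' _ => ?_
    split_ifs <;> simp
  rw [hH, ← integral_const_mul]
  have hc2n := hc2.norm_bilinear
  refine setIntegral_mono_on
    (hi _ (((hc0.abs.add (continuousOn_const.mul hc1.norm)).add hc2n).pow 2))
    ((hi01.add hi2ss).const_mul _) measurableSet_Icc fun x hx => ?_
  have hd1 : (1 : ℝ) ≤ d := by exact_mod_cast hd
  set S1 := ∑ j, pd d j R x ^ 2
  set S2 := ∑ j, ∑ j', if j ≤ j' then pd d j (pd d j' R) x ^ 2 else 0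
  have hS1 : 0 ≤ S1 := Finset.sum_nonneg fun j _ => sq_nonneg _
  have hS2 : 0 ≤ S2 := Finset.sum_nonneg fun j _ => Finset.sum_nonneg fun j' _ => by
    split_ifs <;> positivity
  have h1 : ‖fderiv ℝ R x‖ ^ 2 ≤ d * S1 := by
    have hle : ‖fderiv ℝ R x‖ ≤ ∑ j, |pd d j R x| := norm_clm_le_sum_single _
    refine (pow_le_pow_left₀ (norm_nonneg _) hle 2).trans ?_
    simpa using sq_sum_le_card_mul_sum_sq (s := Finset.univ) (f := fun j => |pd d j R x|)
  have h2 : ‖fderiv ℝ (fderiv ℝ R) x‖ ^ 2 ≤ d ^ 2 * (2 * S2) := by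
    have hle : ‖fderiv ℝ (fderiv ℝ R) x‖ ≤ ∑ j, ∑ j', |pd d j (pd d j' R) x| := by
      refine (norm_clm_le_sum_single _).trans (Finset.sum_le_sum fun j _ => ?_)
      refine (norm_clm_le_sum_single _).trans (Finset.sum_le_sum fun j' _ => ?_)
      rw [hpd x hx, Real.norm_eq_abs]
    have hsymm : ∀ j j', pd d j (pd d j' R) x ^ 2 = pd d j' (pd d j R) x ^ 2 := fun j j' => by
      rw [hpd x hx, hpd x hx, ((hR.contDiffAt (hU.mem_nhds (hcU hx))).isSymmSndFDerivAt
        (by simp)).eq]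
    have hss := sum_sum_le_two_mul_sum_le (A := fun j j' => pd d j (pd d j' R) x ^ 2)
      (fun _ _ => sq_nonneg _) hsymm
    refine (pow_le_pow_left₀ (ContinuousLinearMap.opNorm_nonneg _) hle 2).trans ?_
    refine le_trans ?_ (mul_le_mul_of_nonneg_left hss (sq_nonneg _))
    rw [← Fintype.sum_prod_type', ← Fintype.sum_prod_type']
    have := sq_sum_le_card_mul_sum_sq (s := (Finset.univ : Finset (Fin d × Fin d)))
      (f := fun q => |pd d q.1 (pd d q.2 R) x|)
    simpa [sq_abs, sq] using this
  have h3 : (|R x| + 2 * ‖fderiv ℝ R x‖ + ‖fderiv ℝ (fderiv ℝ R) x‖) ^ 2 ≤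
      6 * (R x ^ 2 + ‖fderiv ℝ R x‖ ^ 2 + ‖fderiv ℝ (fderiv ℝ R) x‖ ^ 2) := by
    rw [← sq_abs (R x)]
    nlinarith [sq_nonneg (2 * |R x| - ‖fderiv ℝ R x‖),
      sq_nonneg (|R x| - ‖fderiv ℝ (fderiv ℝ R) x‖),
      sq_nonneg (2 * ‖fderiv ℝ (fderiv ℝ R) x‖ - ‖fderiv ℝ R x‖)]
  have h4 : (d : ℝ) ≤ d ^ 2 := by nlinarith
  nlinarith [sq_nonneg (R x), mul_le_mul_of_nonneg_right h4 hS1,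
    mul_nonneg (sq_nonneg (d : ℝ)) hS1, mul_nonneg (sq_nonneg (d : ℝ)) hS2,
    mul_nonneg (sub_nonneg.2 (hd1.trans h4)) (sq_nonneg (R x))]

/-- **Quadrature error for the discrete spectral coefficients.**
For `d ∈ {1,2,3}` there is a constant `C = C(d) > 0` such that for every `n ≥ 1`
(with `h = 1/(n+1)`), every multi-index `k ∈ {1,…,n}^d`, and every `R` twice continuously
differentiable near `[0,1]^d`,
`|⟨R,φ_k⟩_h - ∫_{[0,1]^d} R φ_k| ≤ C h² λ_k ‖R‖_{H²}`. -/
theorem stmt_10 (d : ℕ) (hd : d = 1 ∨ d = 2 ∨ d = 3) :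
    ∃ C : ℝ, 0 < C ∧
      ∀ (n : ℕ), 1 ≤ n → ∀ (k : Fin d → Fin n) (R : (Fin d → ℝ) → ℝ), C2Nbhd d R →
      |dInner d n R (eigenFun d (fun j => (k j : ℕ))) -
          ∫ x in cube d, R x * eigenFun d (fun j => (k j : ℕ)) x| ≤
        C * mesh n ^ 2 * lamC d (fun j => (k j : ℕ)) * Real.sqrt (H2sq d R) := by
  have hd0 : 0 < d := by omega
  have hd3 : d ≤ 3 := by omega
  obtain ⟨K, hK, hbound⟩ := exists_norm_fderiv_fderiv_mul_eigenFun_le hd0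
  have hdpos : (0 : ℝ) < d := by exact_mod_cast hd0
  refine ⟨16 * d * K, by positivity, ?_⟩
  rintro n - k R ⟨U, hU, hcU, hR⟩
  set κ : Fin d → ℕ := fun j => (k j : ℕ)
  set g : (Fin d → ℝ) → ℝ := fun x => R x * eigenFun d κ x with hg
  have hgC : ContDiffOn ℝ 2 g U := hR.mul (contDiff_eigenFun d κ).contDiffOn
  have hgC' : ContDiffOn ℝ 1 (fderiv ℝ g) U := hgC.fderiv_of_isOpen hU (by norm_num)
  have hgC'' : ContinuousOn (fderiv ℝ (fderiv ℝ g)) (cube d) :=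
    (hgC'.continuousOn_fderiv_of_isOpen hU le_rfl).mono hcU
  have hzero : ∀ x : Fin d → ℝ, ∀ j, Real.sin (((κ j : ℝ) + 1) * Real.pi * x j) = 0 →
      g x = 0 := fun x j hj => by
    simp only [hg, eigenFun]
    rw [Finset.prod_eq_zero (Finset.mem_univ j) hj]
    simp
  have herr := abs_trapezoid_error_le hd0 hd3 n (g := g) (g' := fderiv ℝ g)
    (fun x hx => ((hgC.differentiableOn two_ne_zero).differentiableAt
      (hU.mem_nhds (hcU hx))).hasFDerivAt)
    (fun x hx => ((hgC'.differentiableOn one_ne_zero).differentiableAt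
      (hU.mem_nhds (hcU hx))).hasFDerivAt) hgC''
    (fun x j hj => hzero x j (by simp [hj]))
    (fun x j hj => hzero x j (by
      rw [hj, mul_one]
      exact_mod_cast Real.sin_nat_mul_pi (κ j + 1)))
  have hlam : 0 ≤ lamC d κ := by
    unfold lamC
    positivity
  have hR' : ContDiffOn ℝ 1 (fderiv ℝ R) U := hR.fderiv_of_isOpen hU (by norm_num)
  have hc2 := ((hR'.continuousOn_fderiv_of_isOpen hU le_rfl).mono hcU).norm_bilinear
  have hcD : ContinuousOn
      (fun x => |R x| + 2 * ‖fderiv ℝ R x‖ + ‖fderiv ℝ (fderiv ℝ R) x‖) (cube d) :=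
    ((hR.continuousOn.mono hcU).abs.add
      (continuousOn_const.mul (hR'.continuousOn.mono hcU).norm)).add hc2
  have hW : ∫ x in cube d, ‖fderiv ℝ (fderiv ℝ g) x‖ ^ 2 ≤
      (K * lamC d κ) ^ 2 * ((4 * d) ^ 2 * H2sq d R) := by
    refine le_trans ?_ (mul_le_mul_of_nonneg_left (integral_sq_derivs_le hd0 hU hcU hR)
      (sq_nonneg _))
    rw [← integral_const_mul]
    refine setIntegral_mono_on ((hgC''.norm_bilinear.pow 2).integrableOn_compact isCompact_Icc)
      (((hcD.pow 2).integrableOn_compact isCompact_Icc).const_mul _) measurableSet_Icc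
      fun x hx => ?_
    rw [← mul_pow]
    exact pow_le_pow_left₀ (ContinuousLinearMap.opNorm_nonneg _) (hbound κ R U hU hR x (hcU hx)) 2
  have hsqrt : Real.sqrt (∫ x in cube d, ‖fderiv ℝ (fderiv ℝ g) x‖ ^ 2) ≤
      K * lamC d κ * (4 * d * Real.sqrt (H2sq d R)) := by
    refine (Real.sqrt_le_sqrt hW).trans (le_of_eq ?_)
    rw [Real.sqrt_mul (sq_nonneg _), Real.sqrt_mul (sq_nonneg _), Real.sqrt_sq (by positivity),
      Real.sqrt_sq (by positivity)]
  refine herr.trans ((mul_le_mul_of_nonneg_left hsqrt (by positivity)).trans (le_of_eq ?_))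
  ring
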